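/- arXiv:1005.4258 — 2 statements merged into one kernel-verified Lean document; each statement's English description precedes it below -/
import Mathlib

section
/- For every positive integer m, multi-indices n, z ∈ ℕ^m, and complex numbers x, y such that x ≠ k·z for every multi-index k with 0 ≤ k ≤ n componentwise, one has ∑_{k=0}^{n} (x/(x − k·z)) · C(x − k·z, k) · C(y + k·z, n − k) = C(x + y, n) (Raney–Mohanty's identity). -/
/-- The multinomial coefficient `C(x, k) = x(x-1)⋯(x-|k|+1)/k!` for `x : ℂ`
and a multi-index `k : Fin m → ℕ`. -/
noncomputable def mchoose {m : ℕ} (x : ℂ) (k : Fin m → ℕ) : ℂ :=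
  (∏ j ∈ Finset.range (∑ i, k i), (x - (j : ℂ))) / ∏ i, (Nat.factorial (k i) : ℂ)

/-- The dot product `k·z = k₁z₁ + ⋯ + kₘzₘ` of multi-indices. -/
def mdot {m : ℕ} (k z : Fin m → ℕ) : ℕ := ∑ i, k i * z i

open Finset Polynomial

theorem one_sub_X_pow_dvd_prod {m : ℕ} (n w : Fin m → ℕ) :
    (1 - X : ℤ[X]) ^ (∑ i, n i) ∣ ∏ i, (1 - X ^ w i) ^ n i := by
  rw [← prod_pow_eq_pow_sum]
  exact prod_dvd_prod_of_dvd _ _ fun i _ => pow_dvd_pow_of_dvd (one_sub_dvd_one_sub_pow X (w i)) _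

theorem prod_one_sub_X_pow_pow {m : ℕ} (n w : Fin m → ℕ) :
    (∏ i, (1 - X ^ w i) ^ n i : ℤ[X]) =
      ∑ k ∈ Iic n, C (∏ i, (-1) ^ k i * ((n i).choose (k i) : ℤ)) * X ^ (∑ i, k i * w i) := by
  have hI : Iic n = Fintype.piFinset fun i => range (n i + 1) := by
    ext k
    simp [Pi.le_def]
  have h (i : Fin m) : (1 - X ^ w i : ℤ[X]) ^ n i =
      ∑ j ∈ range (n i + 1), C ((-1) ^ j * ((n i).choose j : ℤ)) * X ^ (j * w i) := by
    rw [sub_eq_neg_add, add_pow]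
    refine sum_congr rfl fun j _ => ?_
    rw [neg_pow, ← pow_mul, mul_comm (w i) j]
    simp
    ring
  simp_rw [h, hI, prod_univ_sum, map_prod C, ← prod_pow_eq_pow_sum, ← prod_mul_distrib]

/-- An iterated finite difference of total order `∑ i, n i` kills polynomials of lower degree. -/
theorem sum_neg_one_pow_mul_choose_mul_eval_eq_zero {m : ℕ} (n w : Fin m → ℕ) (P : ℂ[X])
    (hP : P.natDegree < ∑ i, n i) :
    ∑ k ∈ Iic n, (∏ i, (-1) ^ k i * ((n i).choose (k i) : ℂ)) *
      P.eval ((∑ i, k i * w i : ℕ) : ℂ) = 0 := by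
  set S := fwdDiff_aux.shiftₗ ℂ ℂ 1 with hS
  have hpow (j : ℕ) (f : ℂ → ℂ) (x : ℂ) : (S ^ j) f x = f (x + j) := by
    induction j generalizing f with
    | zero => simp
    | succ j ih =>
      rw [pow_succ, Module.End.mul_apply, ih, hS, fwdDiff_aux.shiftₗ_apply]
      push_cast
      ring_nf
  obtain ⟨q, hq⟩ := one_sub_X_pow_dvd_prod n w
  have hzero : aeval S (∏ i, (1 - X ^ w i) ^ n i : ℤ[X]) P.eval = 0 := by
    have h1 : aeval S (1 - X : ℤ[X]) = -fwdDiff_aux.fwdDiffₗ ℂ ℂ 1 := by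
      simp [hS, fwdDiff_aux.shiftₗ]
    rw [hq, mul_comm, map_mul, map_pow, h1, Module.End.mul_apply, neg_pow,
      Module.End.mul_apply, fwdDiff_aux.coe_fwdDiffₗ_pow,
      Polynomial.fwdDiff_iter_eq_zero_of_degree_lt hP, map_zero, map_zero]
  have h := congrFun hzero 0
  rw [prod_one_sub_X_pow_pow, map_sum, LinearMap.sum_apply, Finset.sum_apply] at h
  refine Eq.trans ?_ h
  refine sum_congr rfl fun k _ => ?_
  rw [map_mul, aeval_C, map_pow, aeval_X, Module.End.mul_apply, Module.algebraMap_end_apply,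
    Pi.smul_apply, hpow, zero_add, zsmul_eq_mul]
  push_cast
  rfl

theorem prod_range_sub_eq (u : ℂ) (a : ℕ) :
    ∏ j ∈ range a, (u - j) = ∏ j ∈ range a, (u - a + 1 + j) := by
  rw [← prod_range_reflect]
  refine prod_congr rfl fun j hj => ?_
  have : j + 1 ≤ a := mem_range.mp hj
  rw [Nat.sub_sub, add_comm 1 j, Nat.cast_sub this]
  push_cast
  ring

theorem prod_range_sub_mul_prod_range_neg_sub (u : ℂ) {a b : ℕ} (h : 0 < a + b) :
    (∏ j ∈ range a, (u - j)) * ∏ j ∈ range b, (-u - j) =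
      (-1) ^ b * u * ∏ j ∈ range (a + b - 1), (u - a + 1 + j) := by
  have hb : ∏ j ∈ range b, (-u - (j : ℂ)) = (-1) ^ b * ∏ j ∈ range b, (u + j) := by
    simp_rw [← neg_add', neg_eq_neg_one_mul (u + _), prod_mul_distrib, prod_const, card_range]
  rw [prod_range_sub_eq, hb]
  rcases b with _ | b
  · obtain ⟨a, rfl⟩ : ∃ c, a = c + 1 := ⟨a - 1, by omega⟩
    rw [prod_range_succ]
    simp
    ring
  · rw [prod_range_succ' _ b, show a + (b + 1) - 1 = a + b by omega, prod_range_add]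
    have : ∏ j ∈ range b, (u - a + 1 + ((a + j : ℕ) : ℂ)) =
        ∏ j ∈ range b, (u + ((j + 1 : ℕ) : ℂ)) :=
      prod_congr rfl fun j _ => by push_cast; ring
    rw [this]
    push_cast
    ring

theorem prod_factorial_ne_zero {m : ℕ} (n : Fin m → ℕ) :
    ∏ i, (Nat.factorial (n i) : ℂ) ≠ 0 :=
  prod_ne_zero_iff.mpr fun _ _ => Nat.cast_ne_zero.mpr (Nat.factorial_ne_zero _)

theorem sum_sub_of_le {m : ℕ} {k n : Fin m → ℕ} (h : k ≤ n) :
    ∑ i, (n - k) i = ∑ i, n i - ∑ i, k i :=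
  sum_tsub_distrib _ fun _ _ => h _

theorem sum_sub_one_add_one {m : ℕ} {n : Fin m → ℕ} {i : Fin m} (h : n i ≠ 0) :
    ∑ j, (n - Pi.single i 1 : Fin m → ℕ) j + 1 = ∑ j, n j := by
  have hle : Pi.single i 1 ≤ n := by
    intro j
    rcases eq_or_ne j i with rfl | hj
    · simpa using Nat.one_le_iff_ne_zero.mpr h
    · simp [hj]
  rw [sum_sub_of_le hle]
  have := sum_le_sum fun j (_ : j ∈ univ) => hle j
  simp at this ⊢
  omega

/-- The vanishing of Raney's convolution at `y = -x`. -/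
theorem sum_mchoose_neg_eq_zero {m : ℕ} {n : Fin m → ℕ} (z : Fin m → ℕ) (x : ℂ)
    (hn : 0 < ∑ i, n i) (hx : ∀ k ∈ Iic n, x ≠ (mdot k z : ℂ)) :
    ∑ k ∈ Iic n, x / (x - (mdot k z : ℂ)) * mchoose (x - (mdot k z : ℂ)) k *
      mchoose (-x + (mdot k z : ℂ)) (n - k) = 0 := by
  set N := ∑ i, n i with hN
  let P : ℂ[X] := ∏ j ∈ range (N - 1), (C (x + 1 + j) - X)
  have hP : P.natDegree < N := by
    refine (natDegree_prod_le _ _).trans_lt ?_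
    refine (sum_le_card_nsmul _ _ 1 fun j _ => ?_).trans_lt ?_
    · compute_degree
    · simp
      omega
  have key := sum_neg_one_pow_mul_choose_mul_eval_eq_zero n (fun i => z i + 1) P hP
  rw [← mul_zero ((-1) ^ N * x / ∏ i, (Nat.factorial (n i) : ℂ)), ← key, mul_sum]
  refine sum_congr rfl fun k hk => ?_
  have hkn : k ≤ n := mem_Iic.mp hk
  have hu : x - (mdot k z : ℂ) ≠ 0 := sub_ne_zero.mpr (hx k hk)
  have hkN : ∑ i, k i ≤ N := sum_le_sum fun i _ => hkn i
  have hw : (∑ i, k i * (z i + 1) : ℕ) = mdot k z + ∑ i, k i := by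
    simp [mdot, mul_add, sum_add_distrib]
  have hch : ∏ i, ((n i).choose (k i) : ℂ) =
      (∏ i, (Nat.factorial (n i) : ℂ)) /
        ((∏ i, (Nat.factorial (k i) : ℂ)) * ∏ i, (Nat.factorial ((n - k) i) : ℂ)) := by
    rw [← prod_mul_distrib, ← prod_div_distrib]
    exact prod_congr rfl fun i _ => Nat.cast_choose ℂ (hkn i)
  have hPe : P.eval ((mdot k z + ∑ i, k i : ℕ) : ℂ) =
      ∏ j ∈ range (N - 1), (x - (mdot k z : ℂ) - (∑ i, k i : ℕ) + 1 + j) := by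
    rw [eval_prod]
    refine prod_congr rfl fun j _ => ?_
    simp only [eval_sub, eval_C, eval_X]
    push_cast
    ring
  have hprod := prod_range_sub_mul_prod_range_neg_sub (x - (mdot k z : ℂ))
    (a := ∑ i, k i) (b := N - ∑ i, k i) (by omega)
  rw [show ∑ i, k i + (N - ∑ i, k i) - 1 = N - 1 by omega, ← hPe] at hprod
  have hsign : (-1 : ℂ) ^ N = (-1) ^ (N - ∑ i, k i) * (-1) ^ (∑ i, k i) := by
    rw [← pow_add, Nat.sub_add_cancel hkN]
  have hsq : (-1 : ℂ) ^ (∑ i, k i) * (-1) ^ (∑ i, k i) = 1 := by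
    rw [← mul_pow]; simp
  rw [hw, prod_mul_distrib, prod_pow_eq_pow_sum, hch, hsign, mchoose, mchoose,
    sum_sub_of_le hkn, ← hN, show -x + (mdot k z : ℂ) = -(x - mdot k z) by ring]
  have h1 := prod_factorial_ne_zero n
  have h2 := prod_factorial_ne_zero k
  have h3 := prod_factorial_ne_zero (n - k)
  field_simp
  rw [mul_assoc, hprod]
  linear_combination (-x * (x - mdot k z) * (-1) ^ (N - ∑ i, k i) *
    P.eval ((mdot k z + ∑ i, k i : ℕ) : ℂ)) * hsq

theorem mchoose_sub_single {m : ℕ} (y : ℂ) (n : Fin m → ℕ) {i : Fin m} (hi : n i ≠ 0) :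
    mchoose y (n - Pi.single i 1) =
      n i * (∏ j ∈ range (∑ i, n i - 1), (y - j)) / ∏ i, (Nat.factorial (n i) : ℂ) := by
  have hf : (n i : ℂ) * ∏ j, (Nat.factorial ((n - Pi.single i 1 : Fin m → ℕ) j) : ℂ) =
      ∏ j, (Nat.factorial (n j) : ℂ) := by
    rw [← mul_prod_erase univ _ (mem_univ i), ← mul_prod_erase univ _ (mem_univ i), ← mul_assoc]
    congr 1
    · rw [← Nat.mul_factorial_pred hi]
      simp
    · refine prod_congr rfl fun j hj => ?_
      simp [Pi.single_eq_of_ne (ne_of_mem_erase hj)]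
  have hni : (n i : ℂ) ≠ 0 := Nat.cast_ne_zero.mpr hi
  rw [mchoose, ← sum_sub_one_add_one hi, Nat.add_sub_cancel, ← hf, mul_div_mul_left _ _ hni]

/-- Pascal's rule for multinomial coefficients. -/
theorem mchoose_add_one {m : ℕ} (y : ℂ) (n : Fin m → ℕ) :
    mchoose (y + 1) n =
      mchoose y n + ∑ i with n i ≠ 0, mchoose y (n - Pi.single i 1) := by
  have hs : ∑ i with n i ≠ 0, mchoose y (n - Pi.single i 1) =
      ((∑ i, n i : ℕ) : ℂ) * (∏ j ∈ range (∑ i, n i - 1), (y - j)) /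
        ∏ i, (Nat.factorial (n i) : ℂ) := by
    rw [Nat.cast_sum, sum_mul, sum_div, sum_filter]
    refine sum_congr rfl fun i _ => ?_
    split_ifs with hi
    · exact mchoose_sub_single y n hi
    · simp [not_not.mp hi]
  rw [hs, mchoose, mchoose, ← add_div]
  congr 1
  rcases ∑ i, n i with _ | M
  · simp
  · rw [prod_range_succ', prod_range_succ, Nat.add_sub_cancel]
    simp only [Nat.cast_add, Nat.cast_one, add_sub_add_right_eq_sub, Nat.cast_zero]
    ring

theorem exists_polynomial_eval_eq_mchoose_add {m : ℕ} (a : ℂ) (n : Fin m → ℕ) :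
    ∃ P : ℂ[X], ∀ y, P.eval y = mchoose (y + a) n := by
  refine ⟨(∏ j ∈ range (∑ i, n i), (X + C (a - j))) *
    C (∏ i, (Nat.factorial (n i) : ℂ))⁻¹, fun y => ?_⟩
  rw [eval_mul, eval_C, eval_prod, mchoose, div_eq_mul_inv]
  congr 1
  refine prod_congr rfl fun j _ => ?_
  simp
  ring

theorem eval_eq_eval_of_eval_add_one {P : ℂ[X]} (h : ∀ y, P.eval (y + 1) = P.eval y) (y t : ℂ) :
    P.eval y = P.eval t := by
  have hj (j : ℕ) : P.eval (t + j) = P.eval t := by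
    induction j with
    | zero => simp
    | succ j ih => rw [Nat.cast_succ, ← add_assoc, h, ih]
  have hC : P = C (P.eval t) := by
    refine eq_of_infinite_eval_eq _ _ (Set.infinite_of_injective_forall_mem
      (f := fun j : ℕ => t + j) (fun i j hij => ?_) fun j => ?_)
    · simpa using hij
    · simpa using hj j
  rw [hC]
  simp

theorem Iic_sub_single {m : ℕ} {n : Fin m → ℕ} {i : Fin m} (hi : n i ≠ 0) :
    Iic (n - Pi.single i 1) = {k ∈ Iic n | (n - k) i ≠ 0} := by
  ext k
  simp only [mem_Iic, mem_filter, Pi.le_def, Pi.sub_apply]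
  constructor
  · intro h
    refine ⟨fun j => (h j).trans (Nat.sub_le _ _), ?_⟩
    have := h i
    simp at this
    omega
  · rintro ⟨h, h'⟩ j
    rcases eq_or_ne j i with rfl | hj
    · simp
      omega
    · simpa [hj] using h j

/-- Raney's convolution satisfies Pascal's rule in its second argument. -/
theorem sum_mul_mchoose_add_one {m : ℕ} (n : Fin m → ℕ) (A d : (Fin m → ℕ) → ℂ) (y : ℂ) :
    ∑ k ∈ Iic n, A k * mchoose (y + 1 + d k) (n - k) =
      ∑ k ∈ Iic n, A k * mchoose (y + d k) (n - k) +
        ∑ i with n i ≠ 0, ∑ k ∈ Iic (n - Pi.single i 1),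
          A k * mchoose (y + d k) (n - Pi.single i 1 - k) := by
  simp_rw [add_right_comm y 1, mchoose_add_one, mul_add, sum_add_distrib, mul_sum]
  congr 1
  simp_rw [tsub_right_comm]
  refine sum_comm' fun k i => ?_
  simp only [mem_filter, mem_univ, true_and]
  constructor
  · rintro ⟨hk, hi⟩
    have hni : n i ≠ 0 := by
      simp at hi
      omega
    rw [Iic_sub_single hni]
    exact ⟨mem_filter.mpr ⟨hk, hi⟩, hni⟩
  · rintro ⟨hk, hni⟩
    rw [Iic_sub_single hni] at hk
    exact mem_filter.mp hk

theorem sum_mchoose_eq_mchoose_add {m : ℕ} (z : Fin m → ℕ) (x : ℂ) (N : ℕ) (n : Fin m → ℕ)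
    (hN : ∑ i, n i = N) (hx : ∀ k ∈ Iic n, x ≠ (mdot k z : ℂ)) (y : ℂ) :
    ∑ k ∈ Iic n, x / (x - (mdot k z : ℂ)) * mchoose (x - (mdot k z : ℂ)) k *
      mchoose (y + (mdot k z : ℂ)) (n - k) = mchoose (x + y) n := by
  induction N generalizing n y with
  | zero =>
    obtain rfl : n = 0 := by
      ext i
      simpa using (sum_eq_zero_iff.mp hN) i (mem_univ i)
    have h0 : x ≠ 0 := by simpa [mdot] using hx 0 (mem_Iic.mpr le_rfl)
    have hI : Iic (0 : Fin m → ℕ) = {0} := by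
      ext k
      simp
    simp [hI, mdot, mchoose, h0]
  | succ N ih =>
    choose Q hQ using fun k => exists_polynomial_eval_eq_mchoose_add (mdot k z : ℂ) (n - k)
    obtain ⟨R, hR⟩ := exists_polynomial_eval_eq_mchoose_add x n
    let P : ℂ[X] := ∑ k ∈ Iic n,
      C (x / (x - (mdot k z : ℂ)) * mchoose (x - (mdot k z : ℂ)) k) * Q k - R
    have hP (y : ℂ) : P.eval y = ∑ k ∈ Iic n, x / (x - (mdot k z : ℂ)) *
        mchoose (x - (mdot k z : ℂ)) k * mchoose (y + (mdot k z : ℂ)) (n - k) -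
          mchoose (x + y) n := by
      simp only [P, eval_sub, eval_finsetSum, eval_mul, eval_C, hQ, hR, add_comm x y]
    have hper (y : ℂ) : P.eval (y + 1) = P.eval y := by
      rw [hP, hP, sum_mul_mchoose_add_one, ← add_assoc, mchoose_add_one, add_sub_add_comm,
        add_eq_left, sub_eq_zero]
      refine sum_congr rfl fun i hi => ?_
      have hi : n i ≠ 0 := (mem_filter.mp hi).2
      refine ih _ ?_ (fun k hk => hx k ?_) y
      · have := sum_sub_one_add_one hi
        omega
      · exact mem_Iic.mpr ((mem_Iic.mp hk).trans tsub_le_self)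
    have hzero : P.eval (-x) = 0 := by
      rw [hP, sum_mchoose_neg_eq_zero z x (by omega) hx, mchoose, hN, prod_range_succ']
      simp
    rw [← sub_eq_zero, ← hP, eval_eq_eval_of_eval_add_one hper y (-x), hzero]

/-- **Raney–Mohanty's identity.** -/
theorem raney_mohanty (m : ℕ) (hm : 0 < m) (n z : Fin m → ℕ) (x y : ℂ)
    (hx : ∀ k ∈ Finset.Iic n, x ≠ (mdot k z : ℂ)) :
    ∑ k ∈ Finset.Iic n,
        x / (x - (mdot k z : ℂ)) * mchoose (x - (mdot k z : ℂ)) k *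
          mchoose (y + (mdot k z : ℂ)) (n - k) =
      mchoose (x + y) n :=
  sum_mchoose_eq_mchoose_add z x _ n rfl hx y
end

section
/- For every positive integer m, multi-indices n, z ∈ ℕ^m, and complex numbers x, y such that x ≠ k·z and y ≠ (n − k)·z for every multi-index k with 0 ≤ k ≤ n componentwise, and x + y ≠ n·z, one has ∑_{k=0}^{n} (xy/((x − k·z)(y − (n − k)·z))) · C(x − k·z, k) · C(y − (n − k)·z, n − k) = ((x + y)/(x + y − n·z)) · C(x + y − n·z, n) (Raney–Mohanty's second identity). -/
open Polynomial in
/-- The polynomial in `x` whose value is `x / (x - k·z) * C(x - k·z, k)` away from `x = k·z`. -/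
noncomputable def raneyPoly {m : ℕ} (z k : Fin m → ℕ) : ℂ[X] :=
  if k = 0 then 1
  else C (∏ i, ((k i).factorial : ℂ))⁻¹ *
    (X * ∏ j ∈ Finset.range (∑ i, k i - 1), (X - C ((mdot k z : ℂ) + (j + 1))))

section RaneyPoly

variable {m : ℕ} (z : Fin m → ℕ)

@[simp]
lemma raneyPoly_zero : raneyPoly z 0 = 1 := if_pos rfl

lemma eval_raneyPoly {k : Fin m → ℕ} (hk : k ≠ 0) (x : ℂ) :
    (raneyPoly z k).eval x = (∏ i, ((k i).factorial : ℂ))⁻¹ *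
      (x * ∏ j ∈ Finset.range (∑ i, k i - 1), (x - mdot k z - (j + 1))) := by
  simp [raneyPoly, hk, Polynomial.eval_prod, sub_sub]

lemma eval_zero_raneyPoly {k : Fin m → ℕ} (hk : k ≠ 0) : (raneyPoly z k).eval 0 = 0 := by
  simp [eval_raneyPoly z hk]

lemma sum_pos_of_ne_zero {k : Fin m → ℕ} (hk : k ≠ 0) : 0 < ∑ i, k i := by
  obtain ⟨i, hi⟩ := Function.ne_iff.mp hk
  exact Finset.sum_pos' (fun _ _ => Nat.zero_le _) ⟨i, Finset.mem_univ i, Nat.pos_of_ne_zero hi⟩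

lemma div_mul_mchoose_eq_eval_raneyPoly (k : Fin m → ℕ) {x : ℂ} (hx : x ≠ mdot k z) :
    x / (x - mdot k z) * mchoose (x - mdot k z) k = (raneyPoly z k).eval x := by
  have hx' : x - mdot k z ≠ 0 := sub_ne_zero.mpr hx
  by_cases hk : k = 0
  · subst hk
    have h0 : mdot 0 z = 0 := by simp [mdot]
    rw [h0] at hx' ⊢
    simp only [Nat.cast_zero, sub_zero] at hx' ⊢
    simp [mchoose, hx']
  · obtain ⟨N, hN⟩ := Nat.exists_eq_add_of_lt (sum_pos_of_ne_zero hk)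
    rw [eval_raneyPoly z hk, mchoose, hN]
    simp only [zero_add, Nat.add_sub_cancel, Finset.prod_range_succ', Nat.cast_zero, sub_zero,
      Nat.cast_add, Nat.cast_one]
    field_simp

lemma sum_add_single (k : Fin m → ℕ) (i : Fin m) :
    ∑ j, (k + Pi.single i 1 : Fin m → ℕ) j = ∑ j, k j + 1 := by
  simp [Finset.sum_add_distrib]

lemma mdot_add_single (k : Fin m → ℕ) (i : Fin m) :
    mdot (k + Pi.single i 1) z = mdot k z + z i := by
  simp [mdot, add_mul, Finset.sum_add_distrib, Pi.single_apply]

lemma prod_factorial_add_single (k : Fin m → ℕ) (i : Fin m) :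
    ∏ j, ((k + Pi.single i 1 : Fin m → ℕ) j).factorial = (k i + 1) * ∏ j, (k j).factorial := by
  rw [← Finset.mul_prod_erase _ _ (Finset.mem_univ i),
    ← Finset.mul_prod_erase _ (fun j => (k j).factorial) (Finset.mem_univ i), ← mul_assoc]
  congr 1
  · simp [Nat.factorial_succ]
  · refine Finset.prod_congr rfl fun j hj => ?_
    simp [Finset.ne_of_mem_erase hj]

lemma sub_single_add_single {n : Fin m → ℕ} {i : Fin m} (hi : n i ≠ 0) :
    n - Pi.single i 1 + Pi.single i 1 = n :=
  tsub_add_cancel_of_le fun j => by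
    rcases eq_or_ne j i with rfl | hj
    · simpa using Nat.one_le_iff_ne_zero.mpr hi
    · simp [hj]

lemma eval_raneyPoly_sub_single {n : Fin m → ℕ} (hn : 2 ≤ ∑ j, n j) {i : Fin m} (hi : n i ≠ 0)
    (x : ℂ) :
    (raneyPoly z (n - Pi.single i 1)).eval (x - z i) = (∏ j, ((n j).factorial : ℂ))⁻¹ *
      (n i * (x - z i) * ∏ j ∈ Finset.range (∑ j, n j - 2), (x - mdot n z - (j + 1))) := by
  obtain ⟨k, rfl⟩ : ∃ k : Fin m → ℕ, n = k + Pi.single i 1 := ⟨_, (sub_single_add_single hi).symm⟩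
  rw [sum_add_single] at hn
  have hk : k ≠ 0 := by
    rintro rfl
    simp at hn
  have hf : (∏ j, (((k + Pi.single i 1 : Fin m → ℕ) j).factorial : ℂ)) =
      (k i + 1) * ∏ j, ((k j).factorial : ℂ) := mod_cast prod_factorial_add_single k i
  have hi' : (k i + 1 : ℂ) ≠ 0 := by exact_mod_cast Nat.succ_ne_zero (k i)
  rw [add_tsub_cancel_right, eval_raneyPoly z hk, hf, sum_add_single, mdot_add_single]
  have hprod : ∀ j : ℕ, x - z i - mdot k z - ((j : ℂ) + 1) =
      x - ((mdot k z + z i : ℕ) : ℂ) - (j + 1) := fun j => by push_cast; ring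
  simp only [hprod, Nat.reduceSubDiff, Pi.add_apply, Pi.single_eq_same, Nat.cast_add, Nat.cast_one,
    mul_inv]
  field_simp

lemma eval_add_one_raneyPoly (n : Fin m → ℕ) (x : ℂ) :
    (raneyPoly z n).eval (x + 1) = (raneyPoly z n).eval x +
      ∑ i, if n i = 0 then 0 else (raneyPoly z (n - Pi.single i 1)).eval (x - z i) := by
  by_cases hn : n = 0
  · simp [hn]
  rcases Nat.lt_or_ge (∑ i, n i) 2 with h | h
  · obtain ⟨i, hi⟩ := Function.ne_iff.mp hn
    obtain ⟨k, rfl⟩ : ∃ k : Fin m → ℕ, n = k + Pi.single i 1 :=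
      ⟨_, (sub_single_add_single hi).symm⟩
    rw [sum_add_single] at h
    obtain rfl : k = 0 := by
      by_contra hk
      have := sum_pos_of_ne_zero hk
      omega
    have hf : (∏ j, (((0 + Pi.single i 1 : Fin m → ℕ) j).factorial : ℂ)) = 1 := by
      have := prod_factorial_add_single 0 i
      simp only [Pi.zero_apply, Nat.factorial_zero, Finset.prod_const_one] at this
      exact_mod_cast this
    rw [eval_raneyPoly z hn, eval_raneyPoly z hn, hf, sum_add_single]
    simp only [Pi.zero_apply, Finset.sum_const_zero]
    rw [Finset.sum_eq_single i]
    · simp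
    · intro j _ hj
      simp [hj]
    · simp
  · have hterm : ∀ i, (if n i = 0 then 0 else (raneyPoly z (n - Pi.single i 1)).eval (x - z i)) =
        (n i * x - n i * z i) * ((∏ j, ((n j).factorial : ℂ))⁻¹ *
          ∏ j ∈ Finset.range (∑ j, n j - 2), (x - mdot n z - (j + 1))) := by
      intro i
      split_ifs with hi
      · simp [hi]
      · rw [eval_raneyPoly_sub_single z h hi]
        ring
    have hmdot : ∑ i, (n i * z i : ℂ) = mdot n z := by simp [mdot]
    simp_rw [hterm]
    rw [← Finset.sum_mul, Finset.sum_sub_distrib, ← Finset.sum_mul, hmdot, ← Nat.cast_sum,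
      eval_raneyPoly z hn, eval_raneyPoly z hn]
    obtain ⟨N, hN⟩ := Nat.exists_eq_add_of_le' h
    rw [hN, show N + 2 - 1 = N + 1 from rfl, Nat.add_sub_cancel,
      Finset.prod_range_succ', Finset.prod_range_succ]
    have hprod : ∀ j : ℕ, x + 1 - (mdot n z : ℂ) - (((j + 1 : ℕ) : ℂ) + 1) =
        x - mdot n z - (j + 1) := fun j => by push_cast; ring
    simp only [hprod]
    push_cast
    ring

lemma sum_Iic_sub_single {n : Fin m → ℕ} (i : Fin m) (f : (Fin m → ℕ) → (Fin m → ℕ) → ℂ) :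
    (∑ k ∈ Finset.Iic n, if k i = 0 then 0 else f (k - Pi.single i 1) (n - k)) =
      if n i = 0 then 0
      else ∑ k ∈ Finset.Iic (n - Pi.single i 1), f k (n - Pi.single i 1 - k) := by
  split_ifs with hn
  · refine Finset.sum_eq_zero fun k hk => if_pos ?_
    exact Nat.le_zero.mp (hn ▸ Finset.mem_Iic.mp hk i)
  simp_rw [← ite_not (_ = 0), ← Finset.sum_filter]
  refine Finset.sum_nbij' (· - Pi.single i 1) (· + Pi.single i 1) ?_ ?_ ?_ ?_ ?_
  · intro k hk
    exact Finset.mem_Iic.mpr (tsub_le_tsub_right (Finset.mem_Iic.mp (Finset.mem_filter.mp hk).1) _)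
  · intro k hk
    refine Finset.mem_filter.mpr ⟨Finset.mem_Iic.mpr ?_, by simp⟩
    calc k + Pi.single i 1 ≤ n - Pi.single i 1 + Pi.single i 1 :=
          add_le_add_left (Finset.mem_Iic.mp hk) _
      _ = n := sub_single_add_single hn
  · intro k hk
    exact sub_single_add_single (Finset.mem_filter.mp hk).2
  · intro k _
    exact add_tsub_cancel_right k _
  · intro k hk
    rw [tsub_tsub, add_comm (Pi.single i 1), sub_single_add_single (Finset.mem_filter.mp hk).2]

lemma eq_zero_of_forall_natCast_eval_eq_zero {p : Polynomial ℂ} (h : ∀ a : ℕ, p.eval (a : ℂ) = 0) :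
    p = 0 :=
  p.eq_zero_of_infinite_isRoot <|
    (Set.infinite_range_of_injective Nat.cast_injective).mono (Set.range_subset_iff.mpr h)

/-- The polynomials `raneyPoly z k` form a sequence of convolution type. -/
theorem sum_eval_raneyPoly_mul (n : Fin m → ℕ) (x y : ℂ) :
    ∑ k ∈ Finset.Iic n, (raneyPoly z k).eval x * (raneyPoly z (n - k)).eval y =
      (raneyPoly z n).eval (x + y) := by
  induction hN : ∑ i, n i generalizing n x y with
  | zero =>
    obtain rfl : n = 0 := by
      by_contra h
      exact (sum_pos_of_ne_zero h).ne' hN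
    have h0 : Finset.Iic (0 : Fin m → ℕ) = {0} := by
      ext k
      simp
    simp [h0]
  | succ N ih =>
    have hstep : ∀ a : ℕ,
        ∑ k ∈ Finset.Iic n, (raneyPoly z k).eval (a : ℂ) * (raneyPoly z (n - k)).eval y =
          (raneyPoly z n).eval (a + y) := by
      intro a
      induction a with
      | zero =>
        rw [Finset.sum_eq_single 0]
        · simp
        · intro k _ hk
          simp [eval_zero_raneyPoly z hk]
        · simp
      | succ a iha =>
        rw [Nat.cast_succ, add_right_comm, eval_add_one_raneyPoly, ← iha]
        simp_rw [eval_add_one_raneyPoly z _ (a : ℂ), add_mul, Finset.sum_add_distrib,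
          Finset.sum_mul, ite_mul, zero_mul]
        rw [Finset.sum_comm]
        congr 1
        refine Finset.sum_congr rfl fun i _ => ?_
        rw [sum_Iic_sub_single i fun k l =>
          (raneyPoly z k).eval ((a : ℂ) - z i) * (raneyPoly z l).eval y]
        split_ifs with hi
        · rfl
        · rw [ih, sub_add_eq_add_sub]
          have := sum_add_single (n - Pi.single i 1) i
          rw [sub_single_add_single hi] at this
          omega
    have hzero : (∑ k ∈ Finset.Iic n,
        raneyPoly z k * Polynomial.C ((raneyPoly z (n - k)).eval y)) -
          (raneyPoly z n).comp (Polynomial.X + Polynomial.C y) = 0 := by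
      refine eq_zero_of_forall_natCast_eval_eq_zero fun a => ?_
      simp [Polynomial.eval_finsetSum, hstep a]
    simpa [Polynomial.eval_finsetSum, sub_eq_zero] using congrArg (Polynomial.eval x) hzero

end RaneyPoly

/-- **Raney–Mohanty's second identity.** -/
theorem raney_mohanty_second (m : ℕ) (hm : 0 < m) (n z : Fin m → ℕ) (x y : ℂ)
    (hx : ∀ k ∈ Finset.Iic n, x ≠ (mdot k z : ℂ))
    (hy : ∀ k ∈ Finset.Iic n, y ≠ (mdot (n - k) z : ℂ))
    (hxy : x + y ≠ (mdot n z : ℂ)) :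
    ∑ k ∈ Finset.Iic n,
        x * y / ((x - (mdot k z : ℂ)) * (y - (mdot (n - k) z : ℂ))) *
          mchoose (x - (mdot k z : ℂ)) k * mchoose (y - (mdot (n - k) z : ℂ)) (n - k) =
      (x + y) / (x + y - (mdot n z : ℂ)) * mchoose (x + y - (mdot n z : ℂ)) n := by
  rw [div_mul_mchoose_eq_eval_raneyPoly z n hxy, ← sum_eval_raneyPoly_mul]
  refine Finset.sum_congr rfl fun k hk => ?_
  rw [← div_mul_mchoose_eq_eval_raneyPoly z k (hx k hk),
    ← div_mul_mchoose_eq_eval_raneyPoly z (n - k) (hy k hk), mul_div_mul_comm]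
  ring
end
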